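/- Let p ≥ 1 and φ ∈ ℝ, and let A and B be p×p real symmetric matrices, regarded as complex matrices. Then e^{iφ} · det(I + i·(B + s·A)) − e^{−iφ} · det(I − i·(B + s·A)) = 0 for all s ∈ ℝ if and only if, for every j = 0, 1, …, p, e^{2iφ} · det(I + i·B) · σ_j( A·(I + i·B)^{-1} ) = (−1)^j · det(I − i·B) · σ_j( A·(I − i·B)^{-1} ). (Here I + i·B and I − i·B are invertible since B is real symmetric.) -/

import Mathlib

open Matrix Polynomial

/-- The elementary symmetric functions `σ_k(M)` of a `p × p` matrix `M`, defined as the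
coefficient of `t^k` in `det(I + t • M)`. -/
noncomputable def esymm {R : Type*} [CommRing R] {p : ℕ} (k : ℕ)
    (M : Matrix (Fin p) (Fin p) R) : R :=
  ((1 + (X : R[X]) • M.map Polynomial.C).det).coeff k

/-- A real matrix regarded as a complex matrix via the canonical inclusion `ℝ → ℂ`. -/
def toC {p : ℕ} (A : Matrix (Fin p) (Fin p) ℝ) : Matrix (Fin p) (Fin p) ℂ :=
  A.map Complex.ofReal

lemma aux_eval {p : ℕ} (M : Matrix (Fin p) (Fin p) ℂ) (t : ℂ) :
    ((1 + (X : ℂ[X]) • M.map Polynomial.C).det).eval t = (1 + t • M).det := by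
  rw [← coe_evalRingHom, RingHom.map_det]
  congr 1
  ext i j
  by_cases h : i = j <;> simp [h] <;> ring

lemma aux_deg {p : ℕ} (M : Matrix (Fin p) (Fin p) ℂ) :
    ((1 + (X : ℂ[X]) • M.map Polynomial.C).det).natDegree ≤ p := by
  have h := natDegree_det_X_add_C_le M 1
  simpa [add_comm] using h

open scoped ComplexOrder in
lemma aux_unit {p : ℕ} (B : Matrix (Fin p) (Fin p) ℝ) (hB : B.IsSymm) :
    (1 + Complex.I • toC B).det ≠ 0 ∧ (1 - Complex.I • toC B).det ≠ 0 := by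
  have hH : (toC B)ᴴ = toC B := by
    ext i j
    have := congrFun (congrFun hB i) j
    simp only [Matrix.transpose_apply] at this
    simp [toC, this]
  have hp : (1 + (toC B)ᴴ * toC B).PosDef :=
    Matrix.PosDef.one.add_posSemidef (Matrix.posSemidef_conjTranspose_mul_self _)
  have h := hp.det_pos.ne'
  have e : 1 + (toC B)ᴴ * toC B = (1 + Complex.I • toC B) * (1 - Complex.I • toC B) := by
    rw [hH]
    simp [add_mul, mul_sub, smul_smul]
    abel
  rw [e, det_mul] at h
  exact mul_ne_zero_iff.mp h

lemma aux_fac {p : ℕ} (A N : Matrix (Fin p) (Fin p) ℂ) (h : N.det ≠ 0) (t : ℂ) :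
    (N + t • A).det = N.det * (1 + t • (A * N⁻¹)).det := by
  rw [mul_comm, ← det_mul, add_mul, one_mul, smul_mul, Matrix.mul_assoc,
    Matrix.nonsing_inv_mul _ h.isUnit, mul_one]

theorem stmt4 {p : ℕ} (hp : 1 ≤ p) (φ : ℝ)
    (A B : Matrix (Fin p) (Fin p) ℝ) (hA : A.IsSymm) (hB : B.IsSymm) :
    (∀ s : ℝ,
        Complex.exp (Complex.I * (φ : ℂ)) *
            (1 + Complex.I • (toC B + (s : ℂ) • toC A)).det -
          Complex.exp (-(Complex.I * (φ : ℂ))) *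
            (1 - Complex.I • (toC B + (s : ℂ) • toC A)).det = 0)
      ↔ ∀ j ≤ p,
          Complex.exp (2 * Complex.I * (φ : ℂ)) * (1 + Complex.I • toC B).det *
              esymm j (toC A * (1 + Complex.I • toC B)⁻¹)
            = (-1 : ℂ) ^ j * (1 - Complex.I • toC B).det *
                esymm j (toC A * (1 - Complex.I • toC B)⁻¹) := by
  obtain ⟨h1, h2⟩ := aux_unit B hB
  set P : ℂ[X] := (1 + (X : ℂ[X]) • (toC A * (1 + Complex.I • toC B)⁻¹).map Polynomial.C).det with hP
  set Q : ℂ[X] := (1 + (X : ℂ[X]) • (toC A * (1 - Complex.I • toC B)⁻¹).map Polynomial.C).det with hQ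
  set a := Complex.exp (2 * Complex.I * (φ : ℂ)) * (1 + Complex.I • toC B).det with ha
  set b := (1 - Complex.I • toC B).det with hb
  set F : ℂ[X] := C a * P - C b * Q.comp (C (-1) * X) with hF
  have hcoeff : ∀ j, F.coeff j = a * P.coeff j - (-1) ^ j * b * Q.coeff j := by
    intro j
    rw [hF, coeff_sub, coeff_C_mul, coeff_C_mul, comp_C_mul_X_coeff]
    ring
  have key : ∀ s : ℝ, Complex.exp (Complex.I * (φ : ℂ)) * (Complex.exp (Complex.I * (φ : ℂ)) *
            (1 + Complex.I • (toC B + (s : ℂ) • toC A)).det -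
          Complex.exp (-(Complex.I * (φ : ℂ))) *
            (1 - Complex.I • (toC B + (s : ℂ) • toC A)).det) = F.eval (Complex.I * s) := by
    intro s
    have e1 : 1 + Complex.I • (toC B + (s : ℂ) • toC A)
        = (1 + Complex.I • toC B) + (Complex.I * s) • toC A := by
      rw [smul_add, smul_smul, add_assoc]
    have e2 : 1 - Complex.I • (toC B + (s : ℂ) • toC A)
        = (1 - Complex.I • toC B) + (-(Complex.I * s)) • toC A := by
      rw [smul_add, smul_smul, neg_smul]; abel
    rw [e1, e2, aux_fac _ _ h1, aux_fac _ _ h2, ← aux_eval _ (Complex.I * s), ← aux_eval _ (-(Complex.I * s)), ← hP, ← hQ, hF, ha, ← hb]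
    have x1 : Complex.exp (2 * Complex.I * (φ : ℂ))
      = Complex.exp (Complex.I * φ) * Complex.exp (Complex.I * φ) := by
      rw [← Complex.exp_add]; ring_nf
    have x2 : Complex.exp (Complex.I * φ) * Complex.exp (-(Complex.I * φ)) = 1 := by
      rw [← Complex.exp_add]; simp
    simp only [eval_sub, eval_mul, eval_C, eval_comp, eval_neg, eval_X, x1, neg_one_mul]
    linear_combination (-(b * eval (-(Complex.I * s)) Q)) * x2
  have L : (∀ s : ℝ, F.eval (Complex.I * s) = 0) ↔ F = 0 := by
    constructor
    · intro h
      apply eq_zero_of_infinite_isRoot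
      apply Set.infinite_of_injective_forall_mem (f := fun s : ℝ => Complex.I * (s : ℂ))
      · intro x y hxy
        simpa using hxy
      · intro s
        exact h s
    · intro h; simp [h]
  have R : F = 0 ↔ ∀ j ≤ p, a * P.coeff j = (-1) ^ j * b * Q.coeff j := by
    constructor
    · intro h j _
      rw [← sub_eq_zero, ← hcoeff, h, coeff_zero]
    · intro h
      ext j
      rw [hcoeff, coeff_zero]
      by_cases hj : j ≤ p
      · rw [h j hj, sub_self]
      · rw [coeff_eq_zero_of_natDegree_lt (lt_of_le_of_lt (aux_deg _) (not_le.mp hj)),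
          coeff_eq_zero_of_natDegree_lt (lt_of_le_of_lt (aux_deg _) (not_le.mp hj))]
        simp
  refine Iff.trans ?_ (L.trans R)
  refine forall_congr' fun s => ?_
  rw [← key s, mul_eq_zero, or_iff_right (Complex.exp_ne_zero _)]
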